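/- Let θ : ℝ → ℂ have a distributional derivative θ' with ∫_ℝ |θ(x)| e^{β|x|/2} dx < ∞, ∫_ℝ |θ'(x)| e^{β|x|/2} dx < ∞ and ∫_ℝ θ(x) dx = 0. For each k ∈ ℕ₀ there exists a function f_k ∈ ℰ whose Fourier transform is f̂_k(ξ) = (iξ)^k exp(−ξ²/2 + ∫_0^1 θ̂(ξs)/s ds) for ξ ∈ ℝ. The function f_k is the k-th distributional derivative of f₀, f₀ has unit mass (∫_ℝ f₀(x) dx = f̂₀(0) = 1), and f_k satisfies 𝔏f_k + θ*f_k = −k f_k in the distributional sense; in particular f₀ is a stationary solution of the perturbed Fokker–Planck equation with unit mass. -/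

import Mathlib

open MeasureTheory Complex
open scoped ContDiff

/-- Membership in `ℰ = L²(ℝ, cosh(βx) dx)`. -/
def memE (β : ℝ) (f : ℝ → ℂ) : Prop :=
  AEStronglyMeasurable f volume ∧
    Integrable (fun x : ℝ => ‖f x‖ ^ 2 * Real.cosh (β * x))

/-- Fourier transform with the paper's normalization, at a real frequency. -/
noncomputable def FT (f : ℝ → ℂ) (ξ : ℝ) : ℂ :=
  ∫ x : ℝ, f x * Complex.exp (-(Complex.I * x * ξ))

/-- `f'` is the distributional derivative of `f`. -/
def IsDistribDeriv (f f' : ℝ → ℂ) : Prop :=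
  ∀ φ : ℝ → ℂ, ContDiff ℝ ∞ φ → HasCompactSupport φ →
    ∫ x : ℝ, f x * deriv φ x = -∫ x : ℝ, f' x * φ x

/-- The convolution `(θ * f)(x) = ∫ θ(x−y) f(y) dy`. -/
noncomputable def conv (θ f : ℝ → ℂ) (x : ℝ) : ℂ := ∫ y : ℝ, θ (x - y) * f y

/-- `𝔏 f + θ*f = ζ f` in the distributional sense. -/
def PerturbedEigenEq (θ : ℝ → ℂ) (ζ : ℂ) (f : ℝ → ℂ) : Prop :=
  ∀ φ : ℝ → ℂ, ContDiff ℝ ∞ φ → HasCompactSupport φ →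
    (∫ x : ℝ, f x * (deriv (deriv φ) x - x * deriv φ x))
      + (∫ x : ℝ, conv θ f x * φ x) = ζ * ∫ x : ℝ, f x * φ x

/-- The Fourier transform of the stationary state:
`f̂₀(ξ) = exp(−ξ²/2 + ∫_0^1 θ̂(ξs)/s ds)`. -/
noncomputable def fhat0 (θ : ℝ → ℂ) (ξ : ℝ) : ℂ :=
  Complex.exp (-(ξ : ℂ) ^ 2 / 2 + ∫ s in (0:ℝ)..1, FT θ (ξ * s) / s)

/-- The open horizontal strip `|Im z| < a`. -/
def strip (a : ℝ) : Set ℂ := {z | |z.im| < a}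

/-- The Fourier transform at a complex frequency. -/
noncomputable def complexFT (f : ℝ → ℂ) (z : ℂ) : ℂ :=
  ∫ x : ℝ, f x * Complex.exp (-(Complex.I * x * z))

lemma isOpen_strip (a : ℝ) : IsOpen (strip a) :=
  isOpen_lt (by fun_prop) continuous_const

lemma convex_strip (a : ℝ) : Convex ℝ (strip a) := by
  have h : strip a = Complex.imCLM ⁻¹' Set.Ioo (-a) a := by
    ext z; simp [strip, abs_lt]
  rw [h]
  exact (convex_Ioo (-a) a).is_linear_preimage Complex.imCLM.toLinearMap.isLinear

lemma ofReal_mem_strip {a : ℝ} (ha : 0 < a) (x : ℝ) : (x : ℂ) ∈ strip a := by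
  simpa [strip] using ha

lemma zero_mem_strip {a : ℝ} (ha : 0 < a) : (0 : ℂ) ∈ strip a := by
  simpa [strip] using ha

lemma norm_cexp_neg_I_mul_le (x : ℝ) (z : ℂ) :
    ‖Complex.exp (-(Complex.I * x * z))‖ ≤ Real.exp (|z.im| * |x|) := by
  rw [Complex.norm_exp]
  apply Real.exp_le_exp.2
  have : (-(Complex.I * x * z)).re = z.im * x := by simp; ring
  rw [this, ← abs_mul]
  exact le_abs_self _

lemma norm_mul_cexp_neg_I_mul_le {a : ℝ} (f : ℝ → ℂ) (x : ℝ) {z : ℂ} (hz : z ∈ strip a) :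
    ‖f x * Complex.exp (-(Complex.I * x * z))‖ ≤ ‖f x‖ * Real.exp (a * |x|) := by
  rw [norm_mul]
  gcongr
  refine (norm_cexp_neg_I_mul_le x z).trans ?_
  gcongr
  exact le_of_lt hz

lemma aestronglyMeasurable_mul_cexp {f : ℝ → ℂ} (hf : AEStronglyMeasurable f volume) (z : ℂ) :
    AEStronglyMeasurable (fun x : ℝ => f x * Complex.exp (-(Complex.I * x * z))) volume :=
  hf.mul (by fun_prop : Continuous fun x : ℝ => Complex.exp (-(Complex.I * x * z))).aestronglyMeasurable

lemma integrable_mul_cexp {a : ℝ} {f : ℝ → ℂ} (hf : AEStronglyMeasurable f volume)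
    (hint : Integrable fun x : ℝ => ‖f x‖ * Real.exp (a * |x|)) {z : ℂ} (hz : z ∈ strip a) :
    Integrable fun x : ℝ => f x * Complex.exp (-(Complex.I * x * z)) :=
  hint.mono' (aestronglyMeasurable_mul_cexp hf z)
    (.of_forall fun x => norm_mul_cexp_neg_I_mul_le f x hz)

lemma norm_complexFT_le {a : ℝ} {f : ℝ → ℂ}
    (hint : Integrable fun x : ℝ => ‖f x‖ * Real.exp (a * |x|)) {z : ℂ} (hz : z ∈ strip a) :
    ‖complexFT f z‖ ≤ ∫ x : ℝ, ‖f x‖ * Real.exp (a * |x|) :=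
  norm_integral_le_of_norm_le hint (.of_forall fun x => norm_mul_cexp_neg_I_mul_le f x hz)

lemma differentiableOn_complexFT {a : ℝ} {f : ℝ → ℂ} (hf : AEStronglyMeasurable f volume)
    (hint : Integrable fun x : ℝ => ‖f x‖ * Real.exp (a * |x|)) :
    DifferentiableOn ℂ (complexFT f) (strip a) := by
  intro z hz
  obtain ⟨b, hzb, hba⟩ := exists_between (show |z.im| < a from hz)
  have hs : strip b ∈ nhds z := (isOpen_strip b).mem_nhds hzb
  have key := hasDerivAt_integral_of_dominated_loc_of_deriv_le (μ := volume)
    (F := fun (w : ℂ) (x : ℝ) => f x * Complex.exp (-(Complex.I * x * w)))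
    (F' := fun (w : ℂ) (x : ℝ) =>
      f x * (Complex.exp (-(Complex.I * x * w)) * (-(Complex.I * x))))
    (bound := fun x : ℝ => (a - b)⁻¹ * (‖f x‖ * Real.exp (a * |x|))) hs
    (.of_forall fun w => aestronglyMeasurable_mul_cexp hf w)
    (integrable_mul_cexp hf hint hz)
    (hf.mul (by fun_prop : Continuous fun x : ℝ =>
      Complex.exp (-(Complex.I * x * z)) * (-(Complex.I * x))).aestronglyMeasurable)
    (.of_forall fun x w hw => ?_) (hint.const_mul _) (.of_forall fun x w _ => ?_)
  · exact key.2.differentiableAt.differentiableWithinAt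
  · have h1 : |x| ≤ (a - b)⁻¹ * Real.exp ((a - b) * |x|) := by
      rw [inv_mul_eq_div, le_div_iff₀ (by linarith)]
      have := Real.add_one_le_exp ((a - b) * |x|)
      linarith
    have h2 : ‖Complex.exp (-(Complex.I * x * w))‖ ≤ Real.exp (b * |x|) := by
      refine (norm_cexp_neg_I_mul_le x w).trans ?_
      gcongr
      exact le_of_lt hw
    calc ‖f x * (Complex.exp (-(Complex.I * x * w)) * (-(Complex.I * x)))‖
        = ‖f x‖ * (‖Complex.exp (-(Complex.I * x * w))‖ * |x|) := by simp
      _ ≤ ‖f x‖ * (Real.exp (b * |x|) * ((a - b)⁻¹ * Real.exp ((a - b) * |x|))) := by gcongr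
      _ = (a - b)⁻¹ * (‖f x‖ * (Real.exp (b * |x|) * Real.exp ((a - b) * |x|))) := by ring
      _ = (a - b)⁻¹ * (‖f x‖ * Real.exp (a * |x|)) := by
        rw [← Real.exp_add]; ring_nf
  · have h : HasDerivAt (fun w : ℂ => -(Complex.I * x * w)) (-(Complex.I * x)) w := by
      simpa using ((hasDerivAt_id' w).const_mul (Complex.I * x)).fun_neg
    exact h.cexp.const_mul _

/-- A bounded holomorphic function on the strip vanishing at the origin is `z` times a bounded
holomorphic function. -/
lemma exists_bounded_quotient {a C : ℝ} (ha : 0 < a) {T : ℂ → ℂ}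
    (hT : DifferentiableOn ℂ T (strip a)) (hb : ∀ z ∈ strip a, ‖T z‖ ≤ C) (h0 : T 0 = 0) :
    ∃ q : ℂ → ℂ, DifferentiableOn ℂ q (strip a) ∧ (∀ z, z * q z = T z) ∧
      ∃ Q, ∀ z ∈ strip a, ‖q z‖ ≤ Q := by
  have hq : DifferentiableOn ℂ (dslope T 0) (strip a) :=
    (Complex.differentiableOn_dslope ((isOpen_strip a).mem_nhds (zero_mem_strip ha))).2 hT
  have hmul : ∀ z, z * dslope T 0 z = T z := fun z => by
    simpa [h0] using sub_smul_dslope T 0 z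
  have hsub : Metric.closedBall (0 : ℂ) (a / 2) ⊆ strip a := fun z hz => by
    have h1 := Complex.abs_im_le_norm z
    have h2 : ‖z‖ ≤ a / 2 := by simpa using hz
    exact (by linarith : |z.im| < a)
  obtain ⟨Q, hQ⟩ := (isCompact_closedBall (0 : ℂ) (a / 2)).exists_bound_of_continuousOn
    (hq.continuousOn.mono hsub)
  refine ⟨dslope T 0, hq, hmul, max Q (C / (a / 2)), fun z hz => ?_⟩
  rcases le_or_gt ‖z‖ (a / 2) with h | h
  · exact (hQ z (by simpa using h)).trans (le_max_left _ _)
  · refine le_trans ?_ (le_max_right _ _)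
    rw [le_div_iff₀ (by linarith)]
    have h1 := hb z hz
    rw [← hmul z, norm_mul] at h1
    nlinarith [norm_nonneg (dslope T 0 z)]

/-- A bounded holomorphic function on the strip has a primitive of linear growth. -/
lemma exists_primitive {a Q : ℝ} (ha : 0 < a) {q : ℂ → ℂ}
    (hq : DifferentiableOn ℂ q (strip a)) (hQ : ∀ z ∈ strip a, ‖q z‖ ≤ Q) :
    ∃ P : ℂ → ℂ, P 0 = 0 ∧ (∀ z ∈ strip a, HasDerivAt P (q z) z) ∧
      ∀ z ∈ strip a, ‖P z‖ ≤ Q * ‖z‖ := by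
  have hform : ∀ z ∈ strip a, HasFDerivWithinAt (fun w => q w • (1 : ℂ →L[ℂ] ℂ))
      ((ContinuousLinearMap.toSpanSingleton ℂ (deriv q z • (1 : ℂ →L[ℂ] ℂ))).restrictScalars ℝ)
      (strip a) z := fun z hz =>
    (((hq.differentiableAt ((isOpen_strip a).mem_nhds hz)).hasDerivAt.smul_const
      (1 : ℂ →L[ℂ] ℂ)).hasFDerivAt.restrictScalars ℝ).hasFDerivWithinAt
  obtain ⟨P, hP⟩ :=
    (convex_strip a).exists_forall_hasFDerivWithinAt_of_hasFDerivWithinAt_symmetric hform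
      (fun z _ x _ y _ => by simp; ring)
  have hP' : ∀ z ∈ strip a, HasDerivAt P (q z) z := fun z hz => by
    have h := ((hP z hz).hasFDerivAt ((isOpen_strip a).mem_nhds hz)).hasDerivAt
    simpa using h
  refine ⟨fun z => P z - P 0, by simp, fun z hz => (hP' z hz).sub_const _, fun z hz => ?_⟩
  have := (convex_strip a).norm_image_sub_le_of_norm_hasDerivWithin_le
    (fun w hw => (hP' w hw).hasDerivWithinAt) hQ (zero_mem_strip ha) hz
  simpa using this

lemma integral_div_eq_primitive {q P T : ℂ → ℂ} {a : ℝ} (ha : 0 < a)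
    (hq : DifferentiableOn ℂ q (strip a)) (hT : ∀ z, z * q z = T z)
    (hP : ∀ z ∈ strip a, HasDerivAt P (q z) z) (hP0 : P 0 = 0) (ξ : ℝ) :
    ∫ s in (0 : ℝ)..1, T ((ξ * s : ℝ) : ℂ) / s = P ξ := by
  have hmem : ∀ s : ℝ, ((ξ * s : ℝ) : ℂ) ∈ strip a := fun s => ofReal_mem_strip ha _
  have h1 : ∫ s in (0 : ℝ)..1, T ((ξ * s : ℝ) : ℂ) / s
      = ∫ s in (0 : ℝ)..1, q ((ξ * s : ℝ) : ℂ) * ξ := by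
    refine intervalIntegral.integral_congr_ae (.of_forall fun s hs => ?_)
    rw [Set.uIoc_of_le zero_le_one] at hs
    have hs0 : (s : ℂ) ≠ 0 := by exact_mod_cast hs.1.ne'
    rw [← hT]
    push_cast
    field_simp
  have hd : ∀ s : ℝ, HasDerivAt (fun s : ℝ => P ((ξ * s : ℝ) : ℂ)) (q ((ξ * s : ℝ) : ℂ) * ξ) s := by
    intro s
    have hl : HasDerivAt (fun s : ℝ => ((ξ * s : ℝ) : ℂ)) ξ s := by
      simpa using ((hasDerivAt_id s).const_mul ξ).ofReal_comp
    exact (hP _ (hmem s)).comp s hl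
  have hc : Continuous fun s : ℝ => q ((ξ * s : ℝ) : ℂ) * ξ := by
    refine Continuous.mul ?_ continuous_const
    exact hq.continuousOn.comp_continuous (by fun_prop) hmem
  rw [h1, intervalIntegral.integral_eq_sub_of_hasDerivAt (fun s _ => hd s)
    (hc.intervalIntegrable _ _)]
  simp [hP0]

/-- Holomorphic functions on the strip with uniform Gaussian decay in the real direction. -/
structure GaussDecay (a : ℝ) (H : ℂ → ℂ) : Prop where
  differentiableOn : DifferentiableOn ℂ H (strip a)
  bound : ∃ K, ∀ z ∈ strip a, ‖H z‖ ≤ K * Real.exp (-(1 / 8) * z.re ^ 2)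

/-- The inverse of `FT`, applied to the restriction of `H` to the real line. -/
noncomputable def invFT (H : ℂ → ℂ) (x : ℝ) : ℂ :=
  (2 * Real.pi : ℂ)⁻¹ * ∫ ξ : ℝ, H ξ * Complex.exp (Complex.I * x * ξ)

lemma add_mul_I_mem_strip {a y : ℝ} (hy : |y| < a) (x : ℝ) : (x + y * Complex.I : ℂ) ∈ strip a := by
  simpa [strip] using hy

lemma integrable_exp_neg_mul_abs {a : ℝ} (ha : 0 < a) :
    Integrable fun x : ℝ => Real.exp (-(a * |x|)) := by
  have h := integrable_inv_one_add_sq.comp_mul_left' (R := a / 2) (by positivity)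
  refine h.mono' (by fun_prop) (.of_forall fun x => ?_)
  rw [Real.norm_eq_abs, Real.abs_exp, Real.exp_neg]
  refine inv_anti₀ (by positivity) ?_
  have h1 := Real.quadratic_le_exp_of_nonneg (x := a * |x|) (by positivity)
  have h2 : 0 ≤ a * |x| := by positivity
  have h3 : (a * |x|) ^ 2 = (a * x) ^ 2 := by rw [mul_pow, sq_abs, ← mul_pow]
  nlinarith [sq_nonneg (a * x)]

namespace GaussDecay

variable {a : ℝ} {H : ℂ → ℂ}

lemma continuous_line (h : GaussDecay a H) {y : ℝ} (hy : |y| < a) :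
    Continuous fun x : ℝ => H (x + y * Complex.I) :=
  h.differentiableOn.continuousOn.comp_continuous (by fun_prop) (add_mul_I_mem_strip hy)

lemma integrable_line (h : GaussDecay a H) {y : ℝ} (hy : |y| < a) :
    Integrable fun x : ℝ => H (x + y * Complex.I) := by
  obtain ⟨K, hK⟩ := h.bound
  refine ((integrable_exp_neg_mul_sq (by norm_num : (0 : ℝ) < 1 / 8)).const_mul K).mono'
    (h.continuous_line hy).aestronglyMeasurable (.of_forall fun x => ?_)
  simpa using hK _ (add_mul_I_mem_strip hy x)

lemma continuous_real (h : GaussDecay a H) (ha : 0 < a) : Continuous fun x : ℝ => H x := by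
  simpa using h.continuous_line (y := 0) (by simpa using ha)

lemma integrable_real (h : GaussDecay a H) (ha : 0 < a) : Integrable fun x : ℝ => H x := by
  simpa using h.integrable_line (y := 0) (by simpa using ha)

lemma mul_cexp (h : GaussDecay a H) (x : ℝ) :
    GaussDecay a fun z => H z * Complex.exp (Complex.I * x * z) := by
  refine ⟨h.differentiableOn.mul (by fun_prop), ?_⟩
  obtain ⟨K, hK⟩ := h.bound
  refine ⟨K * Real.exp (a * |x|), fun z hz => ?_⟩
  have h1 : ‖Complex.exp (Complex.I * x * z)‖ ≤ Real.exp (a * |x|) := by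
    have h2 := norm_cexp_neg_I_mul_le (-x) z
    have h3 : |z.im| * |x| ≤ a * |x| := by
      gcongr
      exact le_of_lt hz
    simpa using h2.trans (by simpa using h3)
  calc ‖H z * Complex.exp (Complex.I * x * z)‖
      = ‖H z‖ * ‖Complex.exp (Complex.I * x * z)‖ := norm_mul _ _
    _ ≤ (K * Real.exp (-(1 / 8) * z.re ^ 2)) * Real.exp (a * |x|) := by
      gcongr
      · exact (norm_nonneg _).trans (hK z hz)
      · exact hK z hz
    _ = _ := by ring

lemma const_mul (h : GaussDecay a H) (c : ℂ) : GaussDecay a fun z => c * H z := by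
  refine ⟨h.differentiableOn.const_mul c, ?_⟩
  obtain ⟨K, hK⟩ := h.bound
  refine ⟨‖c‖ * K, fun z hz => ?_⟩
  rw [norm_mul, mul_assoc]
  gcongr
  exact hK z hz

lemma integrable_mul_cexp (h : GaussDecay a H) (ha : 0 < a) (x : ℝ) :
    Integrable fun ξ : ℝ => H ξ * Complex.exp (Complex.I * x * ξ) :=
  (h.mul_cexp x).integrable_real ha

/-- Shift of the contour of integration inside the strip. -/
lemma integral_line_eq (h : GaussDecay a H) (ha : 0 < a) {y : ℝ} (hy : |y| < a) :
    ∫ x : ℝ, H (x + y * Complex.I) = ∫ x : ℝ, H x := by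
  obtain ⟨K, hK⟩ := h.bound
  have hmem : ∀ t ∈ Set.uIcc 0 y, |t| < a := fun t ht => by
    have h1 : |t - 0| ≤ |y - 0| := Set.abs_sub_left_of_mem_uIcc ht
    rw [sub_zero, sub_zero] at h1
    exact h1.trans_lt hy
  have hrect : ∀ R : ℝ, ((∫ x in (-R)..R, H x) - ∫ x in (-R)..R, H (x + y * Complex.I))
      + (Complex.I • (∫ t in (0 : ℝ)..y, H (R + t * Complex.I))
        - Complex.I • ∫ t in (0 : ℝ)..y, H ((-R : ℝ) + t * Complex.I)) = 0 := fun R => by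
    have := Complex.integral_boundary_rect_eq_zero_of_differentiableOn H ⟨-R, 0⟩ ⟨R, y⟩
      (h.differentiableOn.mono fun z hz => hmem _ hz.2)
    simpa [add_sub_assoc] using this
  have hside : ∀ σ : ℝ, σ ^ 2 = 1 →
      Filter.Tendsto (fun R : ℝ => Complex.I • ∫ t in (0 : ℝ)..y, H ((σ * R : ℝ) + t * Complex.I))
        Filter.atTop (nhds 0) := fun σ hσ => by
    have hlim : Filter.Tendsto (fun R : ℝ => K * Real.exp (-(1 / 8) * R ^ 2) * |y - 0|)
        Filter.atTop (nhds 0) := by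
      have h1 : Filter.Tendsto (fun R : ℝ => -(1 / 8) * R ^ 2) Filter.atTop Filter.atBot :=
        (Filter.tendsto_pow_atTop two_ne_zero).const_mul_atTop_of_neg (by norm_num)
      simpa using ((Real.tendsto_exp_atBot.comp h1).const_mul K).mul_const |y - 0|
    refine squeeze_zero_norm (fun R => ?_) hlim
    rw [norm_smul, Complex.norm_I, one_mul]
    refine intervalIntegral.norm_integral_le_of_norm_le_const fun t ht => ?_
    have := hK _ (add_mul_I_mem_strip (hmem t (Set.uIoc_subset_uIcc ht)) (σ * R))
    simpa [mul_pow, hσ] using this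
  have htend := ((intervalIntegral_tendsto_integral (h.integrable_real ha)
      Filter.tendsto_neg_atTop_atBot Filter.tendsto_id).sub
    (intervalIntegral_tendsto_integral (h.integrable_line hy)
      Filter.tendsto_neg_atTop_atBot Filter.tendsto_id)).add
    ((hside 1 (by norm_num)).sub (hside (-1) (by norm_num)))
  have hzero := tendsto_nhds_unique (htend.congr fun R => by simpa using hrect R) tendsto_const_nhds
  simp only [sub_zero, add_zero] at hzero
  exact (sub_eq_zero.1 hzero).symm

lemma exists_norm_invFT_le (h : GaussDecay a H) (ha : 0 < a) :
    ∃ C, ∀ x : ℝ, ‖invFT H x‖ ≤ C * Real.exp (-(a * |x|)) := by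
  obtain ⟨K, hK⟩ := h.bound
  have hshift : ∀ x y : ℝ, |y| < a → ‖∫ ξ : ℝ, H ξ * Complex.exp (Complex.I * x * ξ)‖
      ≤ (∫ ξ : ℝ, K * Real.exp (-(1 / 8) * ξ ^ 2)) * Real.exp (-(x * y)) := fun x y hy => by
    rw [← (h.mul_cexp x).integral_line_eq ha hy, ← integral_mul_const]
    refine norm_integral_le_of_norm_le (((integrable_exp_neg_mul_sq
      (by norm_num : (0 : ℝ) < 1 / 8)).const_mul K).mul_const _) (.of_forall fun ξ => ?_)
    have h1 := hK _ (add_mul_I_mem_strip hy ξ)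
    have h2 : ‖Complex.exp (Complex.I * x * (ξ + y * Complex.I))‖ = Real.exp (-(x * y)) := by
      rw [Complex.norm_exp]
      congr 1
      simp
    rw [norm_mul, h2]
    gcongr
    simpa using h1
  set M := ∫ ξ : ℝ, K * Real.exp (-(1 / 8) * ξ ^ 2)
  refine ⟨(2 * Real.pi)⁻¹ * M, fun x => ?_⟩
  have hb : ∀ b ∈ Set.Ico 0 a, ‖∫ ξ : ℝ, H ξ * Complex.exp (Complex.I * x * ξ)‖
      ≤ M * Real.exp (-(b * |x|)) := fun b hb => by
    rcases le_total 0 x with hx | hx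
    · simpa [abs_of_nonneg hx, mul_comm] using
        hshift x b (by rw [abs_of_nonneg hb.1]; exact hb.2)
    · simpa [abs_of_nonpos hx, mul_comm] using
        hshift x (-b) (by rw [abs_neg, abs_of_nonneg hb.1]; exact hb.2)
  have hlim : Filter.Tendsto (fun b : ℝ => M * Real.exp (-(b * |x|))) (nhdsWithin a (Set.Iio a))
      (nhds (M * Real.exp (-(a * |x|)))) :=
    (Continuous.tendsto (by fun_prop) a).mono_left nhdsWithin_le_nhds
  have hle := ge_of_tendsto hlim (Filter.eventually_of_mem (Ico_mem_nhdsLT ha) hb)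
  have hpi : ‖(2 * Real.pi : ℂ)⁻¹‖ = (2 * Real.pi)⁻¹ := by
    simp [abs_of_pos Real.pi_pos]
  rw [invFT, norm_mul, hpi, mul_assoc]
  have := Real.pi_pos
  gcongr

lemma hasDerivAt_invFT (h : GaussDecay a H) (ha : 0 < a)
    (h' : GaussDecay a fun z => Complex.I * z * H z) (x : ℝ) :
    HasDerivAt (invFT H) (invFT (fun z => Complex.I * z * H z) x) x := by
  have key := hasDerivAt_integral_of_dominated_loc_of_deriv_le (μ := volume)
    (F := fun (x : ℝ) (ξ : ℝ) => H ξ * Complex.exp (Complex.I * x * ξ))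
    (F' := fun (x : ℝ) (ξ : ℝ) => Complex.I * ξ * H ξ * Complex.exp (Complex.I * x * ξ))
    (bound := fun ξ : ℝ => ‖Complex.I * ξ * H ξ‖) (x₀ := x) Filter.univ_mem
    (.of_forall fun x => (h.integrable_mul_cexp ha x).aestronglyMeasurable)
    (h.integrable_mul_cexp ha x) (h'.integrable_mul_cexp ha x).aestronglyMeasurable
    (.of_forall fun ξ x _ => ?_) (h'.integrable_real ha).norm (.of_forall fun ξ x _ => ?_)
  · exact key.2.const_mul _
  · have : ‖Complex.exp (Complex.I * x * ξ)‖ = 1 := by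
      rw [mul_assoc, mul_comm, ← Complex.ofReal_mul, Complex.norm_exp_ofReal_mul_I]
    rw [norm_mul, this, mul_one]
  · have h1 : HasDerivAt (fun x : ℝ => Complex.I * x * ξ) (Complex.I * ξ) x := by
      simpa using ((Complex.ofRealCLM.hasDerivAt (x := x)).const_mul Complex.I).mul_const (ξ : ℂ)
    exact (h1.cexp.const_mul (H ξ)).congr_deriv (by ring)

lemma continuous_invFT (h : GaussDecay a H) (ha : 0 < a)
    (h' : GaussDecay a fun z => Complex.I * z * H z) : Continuous (invFT H) :=
  continuous_iff_continuousAt.2 fun x => (h.hasDerivAt_invFT ha h' x).continuousAt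

lemma mul_invFT (h : GaussDecay a H) (ha : 0 < a) {H' : ℂ → ℂ} (h' : GaussDecay a H')
    (hd : ∀ z ∈ strip a, HasDerivAt H (H' z) z) (x : ℝ) :
    x * invFT H x = invFT (fun z => Complex.I * H' z) x := by
  have hv : ∀ ξ : ℝ, HasDerivAt (fun ξ : ℝ => Complex.exp (Complex.I * x * ξ))
      (Complex.I * x * Complex.exp (Complex.I * x * ξ)) ξ := fun ξ => by
    have h1 : HasDerivAt (fun ξ : ℝ => Complex.I * x * ξ) (Complex.I * x) ξ := by
      simpa using (Complex.ofRealCLM.hasDerivAt (x := ξ)).const_mul (Complex.I * x)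
    exact h1.cexp.congr_deriv (by ring)
  have key := integral_mul_deriv_eq_deriv_mul_of_integrable
    (u := fun ξ : ℝ => H ξ) (u' := fun ξ : ℝ => H' ξ)
    (fun ξ _ => (hd _ (ofReal_mem_strip ha ξ)).comp_ofReal) (fun ξ _ => hv ξ)
    (((h.integrable_mul_cexp ha x).const_mul (Complex.I * x)).congr
      (.of_forall fun ξ => by simp only [Pi.mul_apply]; ring))
    (h'.integrable_mul_cexp ha x) (h.integrable_mul_cexp ha x)
  have h1 : ∫ ξ : ℝ, H ξ * (Complex.I * x * Complex.exp (Complex.I * x * ξ))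
      = Complex.I * x * ∫ ξ : ℝ, H ξ * Complex.exp (Complex.I * x * ξ) := by
    rw [← integral_const_mul]
    exact integral_congr_ae (.of_forall fun ξ => by ring)
  have h2 : ∫ ξ : ℝ, Complex.I * H' ξ * Complex.exp (Complex.I * x * ξ)
      = Complex.I * ∫ ξ : ℝ, H' ξ * Complex.exp (Complex.I * x * ξ) := by
    rw [← integral_const_mul]
    exact integral_congr_ae (.of_forall fun ξ => by ring)
  rw [h1] at key
  rw [invFT, invFT, h2]
  linear_combination (-Complex.I * (2 * Real.pi : ℂ)⁻¹) * key
    + (2 * Real.pi : ℂ)⁻¹ * x * (∫ ξ : ℝ, H ξ * Complex.exp (Complex.I * x * ξ)) * Complex.I_mul_I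

lemma integrable_invFT (h : GaussDecay a H) (ha : 0 < a)
    (h' : GaussDecay a fun z => Complex.I * z * H z) : Integrable (invFT H) := by
  obtain ⟨C, hC⟩ := h.exists_norm_invFT_le ha
  exact ((integrable_exp_neg_mul_abs ha).const_mul C).mono' (h.continuous_invFT ha h').aestronglyMeasurable (.of_forall hC)

open scoped FourierTransform in
lemma FT_invFT (h : GaussDecay a H) (ha : 0 < a)
    (h' : GaussDecay a fun z => Complex.I * z * H z) (ξ : ℝ) : FT (invFT H) ξ = H ξ := by
  set g : ℝ → ℂ := fun v => H ((v * (2 * Real.pi) : ℝ) : ℂ)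
  have hpi : (2 * Real.pi : ℝ) ≠ 0 := by positivity
  have hpi' : (Real.pi : ℂ) ≠ 0 := by exact_mod_cast Real.pi_ne_zero
  have hinv : 𝓕⁻ g = invFT H := by
    ext x
    rw [Real.fourierInv_eq', invFT]
    have hsub := Measure.integral_comp_mul_right
      (fun ξ : ℝ => H ξ * Complex.exp (Complex.I * x * ξ)) (2 * Real.pi)
    rw [abs_of_pos (by positivity), Complex.real_smul] at hsub
    push_cast at hsub
    rw [← hsub]
    refine integral_congr_ae (.of_forall fun v => ?_)
    simp only [g, smul_eq_mul]
    rw [mul_comm]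
    congr 2
    · push_cast; ring
    · simp; ring
  have hgc : Continuous g := (h.continuous_real ha).comp (by fun_prop)
  have hgi : Integrable g := (h.integrable_real ha).comp_mul_right' hpi
  have hfg : Integrable (𝓕 g) := by
    have h1 : 𝓕 g = fun x => invFT H (-x) := by
      ext x
      rw [← hinv, Real.fourierInv_eq_fourier_neg, neg_neg]
    rw [h1]
    exact (h.integrable_invFT ha h').comp_neg
  have hF := congrFun (hgc.fourier_fourierInv_eq hgi hfg) (ξ / (2 * Real.pi))
  rw [hinv, Real.fourier_eq'] at hF
  have hξ : ξ / (2 * Real.pi) * (2 * Real.pi) = ξ := by field_simp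
  simp only [g, hξ] at hF
  rw [← hF, FT]
  refine integral_congr_ae (.of_forall fun x => ?_)
  simp only [smul_eq_mul]
  rw [mul_comm]
  congr 2
  simp
  field_simp

lemma conv_invFT (h : GaussDecay a H) (ha : 0 < a) {θ : ℝ → ℂ} (hθ : Integrable θ) (x : ℝ) :
    conv θ (invFT H) x = invFT (fun z => complexFT θ z * H z) x := by
  have hint : Integrable (Function.uncurry fun y ξ : ℝ =>
      θ (x - y) * (H ξ * Complex.exp (Complex.I * y * ξ))) (volume.prod volume) := by
    have h1 := (hθ.comp_sub_left x).mul_prod (h.integrable_real ha)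
    have h2 : Continuous fun p : ℝ × ℝ => Complex.exp (Complex.I * p.1 * p.2) := by fun_prop
    refine (h1.mul_bdd (c := 1) h2.aestronglyMeasurable (.of_forall fun p => ?_)).congr
      (.of_forall fun p => by simp only [Function.uncurry]; ring)
    rw [mul_assoc, mul_comm, ← Complex.ofReal_mul, Complex.norm_exp_ofReal_mul_I]
  have hinner : ∀ ξ : ℝ, ∫ y : ℝ, θ (x - y) * (H ξ * Complex.exp (Complex.I * y * ξ))
      = complexFT θ ξ * H ξ * Complex.exp (Complex.I * x * ξ) := fun ξ => by
    have h1 := integral_sub_left_eq_self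
      (fun u : ℝ => θ u * (H ξ * Complex.exp (Complex.I * (x - u : ℝ) * ξ))) volume x
    simp only [sub_sub_cancel] at h1
    rw [h1, complexFT, mul_assoc, ← integral_mul_const]
    refine integral_congr_ae (.of_forall fun u => ?_)
    have : Complex.exp (Complex.I * (x - u : ℝ) * ξ)
        = Complex.exp (-(Complex.I * u * ξ)) * Complex.exp (Complex.I * x * ξ) := by
      rw [← Complex.exp_add]
      congr 1
      push_cast
      ring
    simp only [this]
    ring
  calc conv θ (invFT H) x
      = (2 * Real.pi : ℂ)⁻¹ * ∫ y : ℝ, ∫ ξ : ℝ,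
          θ (x - y) * (H ξ * Complex.exp (Complex.I * y * ξ)) := by
        rw [conv, ← integral_const_mul]
        refine integral_congr_ae (.of_forall fun y => ?_)
        simp only [invFT, integral_const_mul]
        ring
    _ = _ := by
        rw [integral_integral_swap hint, invFT]
        simp only [hinner]

lemma add (h : GaussDecay a H) {H₂ : ℂ → ℂ} (h₂ : GaussDecay a H₂) :
    GaussDecay a fun z => H z + H₂ z := by
  refine ⟨h.differentiableOn.add h₂.differentiableOn, ?_⟩
  obtain ⟨K, hK⟩ := h.bound
  obtain ⟨K₂, hK₂⟩ := h₂.bound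
  refine ⟨K + K₂, fun z hz => ?_⟩
  rw [add_mul]
  exact norm_add_le_of_le (hK z hz) (hK₂ z hz)

lemma bdd_mul (h : GaussDecay a H) {q : ℂ → ℂ} (hq : DifferentiableOn ℂ q (strip a))
    {Q : ℝ} (hQ : ∀ z ∈ strip a, ‖q z‖ ≤ Q) : GaussDecay a fun z => q z * H z := by
  refine ⟨hq.mul h.differentiableOn, ?_⟩
  obtain ⟨K, hK⟩ := h.bound
  refine ⟨Q * K, fun z hz => ?_⟩
  rw [norm_mul, mul_assoc]
  exact mul_le_mul (hQ z hz) (hK z hz) (norm_nonneg _) ((norm_nonneg _).trans (hQ z hz))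

lemma invFT_add (h : GaussDecay a H) (ha : 0 < a) {H₂ : ℂ → ℂ} (h₂ : GaussDecay a H₂) (x : ℝ) :
    invFT (fun z => H z + H₂ z) x = invFT H x + invFT H₂ x := by
  simp only [invFT, add_mul]
  rw [integral_add (h.integrable_mul_cexp ha x) (h₂.integrable_mul_cexp ha x), mul_add]

end GaussDecay

lemma invFT_const_mul (c : ℂ) (H : ℂ → ℂ) (x : ℝ) :
    invFT (fun z => c * H z) x = c * invFT H x := by
  simp only [invFT, mul_assoc, integral_const_mul]
  ring

/-- The holomorphic function `(iz)^k exp(-z²/2 + P z)`. -/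
noncomputable def eigenFT (P : ℂ → ℂ) (k : ℕ) (z : ℂ) : ℂ :=
  (Complex.I * z) ^ k * Complex.exp (-z ^ 2 / 2 + P z)

lemma gaussDecay_eigenFT {a Q : ℝ} {P : ℂ → ℂ} (hP : DifferentiableOn ℂ P (strip a))
    (hQ : ∀ z ∈ strip a, ‖P z‖ ≤ Q * ‖z‖) (k : ℕ) : GaussDecay a (eigenFT P k) := by
  refine ⟨?_, ?_⟩
  · unfold eigenFT
    exact DifferentiableOn.mul (by fun_prop)
      (DifferentiableOn.cexp (DifferentiableOn.add (by fun_prop) hP))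
  set L := |k + Q|
  refine ⟨Real.exp (2 * L ^ 2 + L * a + a ^ 2 / 2), fun z hz => ?_⟩
  have hz' : |z.im| < a := hz
  have hpow : ‖(Complex.I * z) ^ k‖ ≤ Real.exp (k * ‖z‖) := by
    rw [norm_pow, norm_mul, Complex.norm_I, one_mul, Real.exp_nat_mul]
    gcongr
    linarith [Real.add_one_le_exp ‖z‖]
  have hre : (-z ^ 2 / 2 + P z).re ≤ (z.im ^ 2 - z.re ^ 2) / 2 + Q * ‖z‖ := by
    have h1 := (Complex.re_le_norm (P z)).trans (hQ z hz)
    have h2 : (-z ^ 2 / 2).re = (z.im ^ 2 - z.re ^ 2) / 2 := by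
      simp [sq]
    rw [Complex.add_re, h2]
    linarith
  rw [eigenFT, norm_mul, Complex.norm_exp, ← Real.exp_add]
  calc _ ≤ Real.exp (k * ‖z‖) * Real.exp ((z.im ^ 2 - z.re ^ 2) / 2 + Q * ‖z‖) := by gcongr
    _ ≤ _ := by
      rw [← Real.exp_add]
      apply Real.exp_le_exp.2
      have h1 : (k + Q) * ‖z‖ ≤ L * (|z.re| + a) := by
        have hn : ‖z‖ ≤ |z.re| + a := (Complex.norm_le_abs_re_add_abs_im z).trans (by linarith)
        exact mul_le_mul (le_abs_self _) hn (norm_nonneg _) (abs_nonneg _)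
      have h2 : z.im ^ 2 ≤ a ^ 2 := by
        rw [← sq_abs z.im]
        gcongr
      have h3 := sq_nonneg (|z.re| - 2 * L)
      have h4 := sq_abs z.re
      nlinarith [sq_nonneg z.re, sq_nonneg L]

lemma I_mul_mul_eigenFT (P : ℂ → ℂ) (k : ℕ) :
    (fun z => Complex.I * z * eigenFT P k z) = eigenFT P (k + 1) := by
  ext z
  simp only [eigenFT, pow_succ]
  ring

/-- The complex derivative of `eigenFT P k` when `P` has derivative `q`. -/
noncomputable def eigenFTDeriv (P q : ℂ → ℂ) (k : ℕ) (z : ℂ) : ℂ :=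
  k * Complex.I * eigenFT P (k - 1) z + Complex.I * eigenFT P (k + 1) z + q z * eigenFT P k z

lemma hasDerivAt_eigenFT {P q : ℂ → ℂ} {z : ℂ} (hP : HasDerivAt P (q z) z) (k : ℕ) :
    HasDerivAt (eigenFT P k) (eigenFTDeriv P q k z) z := by
  have h1 : HasDerivAt (fun z : ℂ => (Complex.I * z) ^ k)
      (k * (Complex.I * z) ^ (k - 1) * Complex.I) z := by
    simpa using ((hasDerivAt_id' z).const_mul Complex.I).fun_pow k
  have h2 : HasDerivAt (fun z : ℂ => -z ^ 2 / 2) (-z) z := by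
    refine (((hasDerivAt_id' z).fun_pow 2).fun_neg.div_const 2).congr_deriv ?_
    simp
    ring
  refine (h1.mul (h2.fun_add hP).cexp).congr_deriv ?_
  simp only [eigenFTDeriv, eigenFT, pow_succ (Complex.I * z)]
  linear_combination (Complex.I * z) ^ k * z * Complex.exp (-z ^ 2 / 2 + P z) * -Complex.I_mul_I

lemma integral_mul_deriv_eq_neg {u u' φ : ℝ → ℂ} (hu : ∀ x, HasDerivAt u (u' x) x)
    (hu' : Continuous u') (hφ : ContDiff ℝ ∞ φ) (hc : HasCompactSupport φ) :
    ∫ x : ℝ, u x * deriv φ x = -∫ x : ℝ, u' x * φ x := by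
  have huc : Continuous u := continuous_iff_continuousAt.2 fun x => (hu x).continuousAt
  have hφ' : Continuous (deriv φ) := hφ.continuous_deriv (by simp)
  exact integral_mul_deriv_eq_deriv_mul_of_integrable (fun x _ => hu x)
    (fun x _ => (hφ.differentiable (by simp) x).hasDerivAt)
    ((huc.mul hφ').integrable_of_hasCompactSupport hc.deriv.mul_left)
    ((hu'.mul hφ.continuous).integrable_of_hasCompactSupport hc.mul_left)
    ((huc.mul hφ.continuous).integrable_of_hasCompactSupport hc.mul_left)

lemma integral_mul_iteratedDeriv {f : ℕ → ℝ → ℂ}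
    (hf : ∀ k x, HasDerivAt (f k) (f (k + 1) x) x) (k : ℕ) {φ : ℝ → ℂ}
    (hφ : ContDiff ℝ ∞ φ) (hc : HasCompactSupport φ) :
    ∫ x : ℝ, f 0 x * iteratedDeriv k φ x = (-1 : ℂ) ^ k * ∫ x : ℝ, f k x * φ x := by
  have hcont : ∀ k, Continuous (f k) := fun k =>
    continuous_iff_continuousAt.2 fun x => (hf k x).continuousAt
  induction k generalizing φ with
  | zero => simp
  | succ k ih =>
    have hφ1 : ContDiff ℝ ∞ (deriv φ) := hφ.iterate_deriv 1
    rw [iteratedDeriv_succ', ih hφ1 hc.deriv,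
      integral_mul_deriv_eq_neg (hf k) (hcont (k + 1)) hφ hc]
    ring

lemma perturbedEigenEq_of_pointwise {f : ℕ → ℝ → ℂ} {θ : ℝ → ℂ}
    (hf : ∀ k x, HasDerivAt (f k) (f (k + 1) x) x) (k : ℕ)
    (h : ∀ x : ℝ, x * f (k + 1) x = -(f (k + 2) x) - (k + 1) * f k x - conv θ (f k) x) :
    PerturbedEigenEq θ (-(k : ℂ)) (f k) := by
  intro φ hφ hc
  have hcont : ∀ k, Continuous (f k) := fun k =>
    continuous_iff_continuousAt.2 fun x => (hf k x).continuousAt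
  have hint : ∀ (k : ℕ), Integrable fun x : ℝ => f k x * φ x := fun k =>
    ((hcont k).mul hφ.continuous).integrable_of_hasCompactSupport hc.mul_left
  have hxint : Integrable fun x : ℝ => (x * f (k + 1) x) * φ x :=
    (((Complex.continuous_ofReal.mul (hcont _)).mul hφ.continuous)).integrable_of_hasCompactSupport
      hc.mul_left
  have hφ1 : ContDiff ℝ ∞ (deriv φ) := hφ.iterate_deriv 1
  have hφ2 : ContDiff ℝ ∞ (deriv (deriv φ)) := hφ.iterate_deriv 2
  have hxf : ∀ x : ℝ, HasDerivAt (fun x : ℝ => x * f k x) (f k x + x * f (k + 1) x) x := fun x => by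
    simpa using (Complex.ofRealCLM.hasDerivAt (x := x)).fun_mul (hf k x)
  have hi1 : Integrable fun x : ℝ => f k x * deriv (deriv φ) x :=
    ((hcont k).mul hφ2.continuous).integrable_of_hasCompactSupport hc.deriv.deriv.mul_left
  have hi2 : Integrable fun x : ℝ => (x * f k x) * deriv φ x :=
    ((Complex.continuous_ofReal.mul (hcont k)).mul
      hφ1.continuous).integrable_of_hasCompactSupport hc.deriv.mul_left
  have h1 : ∫ x : ℝ, f k x * (deriv (deriv φ) x - x * deriv φ x)
      = (∫ x : ℝ, f k x * deriv (deriv φ) x) - ∫ x : ℝ, (x * f k x) * deriv φ x := by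
    rw [← integral_sub hi1 hi2]
    exact integral_congr_ae (.of_forall fun x => by ring)
  have h2 : ∫ x : ℝ, (f k x + x * f (k + 1) x) * φ x
      = (∫ x : ℝ, f k x * φ x) + ∫ x : ℝ, (x * f (k + 1) x) * φ x := by
    rw [← integral_add (hint k) hxint]
    exact integral_congr_ae (.of_forall fun x => by ring)
  have h3 : ∫ x : ℝ, conv θ (f k) x * φ x = -(∫ x : ℝ, f (k + 2) x * φ x)
      - (k + 1) * (∫ x : ℝ, f k x * φ x) - ∫ x : ℝ, (x * f (k + 1) x) * φ x := by
    have hi3 : Integrable fun x : ℝ => -(f (k + 2) x * φ x) := (hint (k + 2)).neg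
    have hi4 : Integrable fun x : ℝ => (k + 1 : ℂ) * (f k x * φ x) := (hint k).const_mul _
    have hi5 : Integrable fun x : ℝ => -(f (k + 2) x * φ x) - (k + 1 : ℂ) * (f k x * φ x) :=
      hi3.sub hi4
    rw [← integral_const_mul, ← integral_neg, ← integral_sub hi3 hi4, ← integral_sub hi5 hxint]
    exact integral_congr_ae (.of_forall fun x => by simp only [h x]; ring)
  rw [h1, integral_mul_deriv_eq_neg (hf k) (hcont (k + 1)) hφ1 hc.deriv,
    integral_mul_deriv_eq_neg (hf (k + 1)) (hcont (k + 2)) hφ hc,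
    integral_mul_deriv_eq_neg hxf
      ((hcont k).add (Complex.continuous_ofReal.mul (hcont (k + 1)))) hφ hc, h2, h3]
  ring

lemma cosh_le_exp_abs (x : ℝ) : Real.cosh x ≤ Real.exp |x| := by
  rw [Real.cosh_eq]
  have h1 := Real.exp_le_exp.2 (le_abs_self x)
  have h2 := Real.exp_le_exp.2 (neg_le_abs x)
  linarith

lemma memE_of_decay {β C₀ C₁ : ℝ} (hβ : 0 < β) {f : ℝ → ℂ} (hf : Continuous f)
    (h₀ : ∀ x : ℝ, ‖f x‖ ≤ C₀ * Real.exp (-(β / 2 * |x|)))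
    (h₁ : ∀ x : ℝ, ‖(x : ℂ) * f x‖ ≤ C₁ * Real.exp (-(β / 2 * |x|))) : memE β f := by
  refine ⟨hf.aestronglyMeasurable, (integrable_inv_one_add_sq.const_mul (C₀ ^ 2 + C₁ ^ 2)).mono'
    (Continuous.aestronglyMeasurable (by fun_prop)) (.of_forall fun x => ?_)⟩
  have hcosh : Real.cosh (β * x) ≤ Real.exp (β / 2 * |x|) ^ 2 := by
    refine (cosh_le_exp_abs _).trans_eq ?_
    rw [← Real.exp_nat_mul, abs_mul, abs_of_pos hβ]
    congr 1
    push_cast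
    ring
  have hsq : ∀ {t C : ℝ}, 0 ≤ t → t ≤ C * Real.exp (-(β / 2 * |x|)) →
      t ^ 2 * Real.exp (β / 2 * |x|) ^ 2 ≤ C ^ 2 := fun {t C} ht h => by
    rw [Real.exp_neg, ← div_eq_mul_inv, le_div_iff₀ (Real.exp_pos _)] at h
    rw [← mul_pow]
    gcongr
  have hx : ‖(x : ℂ) * f x‖ ^ 2 = x ^ 2 * ‖f x‖ ^ 2 := by
    rw [norm_mul, mul_pow, Complex.norm_real, Real.norm_eq_abs, sq_abs]
  have h2 := hsq (norm_nonneg _) (h₀ x)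
  have h3 := hsq (norm_nonneg _) (h₁ x)
  rw [hx] at h3
  rw [Real.norm_of_nonneg (mul_nonneg (sq_nonneg _) (Real.cosh_pos _).le), ← div_eq_mul_inv,
    le_div_iff₀ (by positivity)]
  calc ‖f x‖ ^ 2 * Real.cosh (β * x) * (1 + x ^ 2)
      ≤ ‖f x‖ ^ 2 * Real.exp (β / 2 * |x|) ^ 2 * (1 + x ^ 2) := by gcongr
    _ = ‖f x‖ ^ 2 * Real.exp (β / 2 * |x|) ^ 2
        + x ^ 2 * ‖f x‖ ^ 2 * Real.exp (β / 2 * |x|) ^ 2 := by ring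
    _ ≤ C₀ ^ 2 + C₁ ^ 2 := add_le_add h2 h3

/-- existence of the eigenfunctions `f_k` of the perturbed Fokker–Planck
operator, with `f̂_k(ξ) = (iξ)^k f̂₀(ξ)`, `f_k = f₀^{(k)}` (distributionally),
`∫ f₀ = 1`, and `𝔏 f_k + θ*f_k = −k f_k` distributionally. -/
theorem perturbed_eigenfunctions (β : ℝ) (hβ : 0 < β) (θ θ' : ℝ → ℂ)
    (hθmeas : AEStronglyMeasurable θ volume)
    (hθ'meas : AEStronglyMeasurable θ' volume)
    (hderiv : IsDistribDeriv θ θ')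
    (hθint : Integrable (fun x : ℝ => ‖θ x‖ * Real.exp (β * |x| / 2)))
    (hθ'int : Integrable (fun x : ℝ => ‖θ' x‖ * Real.exp (β * |x| / 2)))
    (hθmass : ∫ x : ℝ, θ x = 0) :
    ∃ f : ℕ → ℝ → ℂ,
      (∀ k : ℕ, memE β (f k)) ∧
      (∀ k : ℕ, ∀ ξ : ℝ, FT (f k) ξ = (Complex.I * ξ) ^ k * fhat0 θ ξ) ∧
      (∀ k : ℕ, ∀ φ : ℝ → ℂ, ContDiff ℝ ∞ φ → HasCompactSupport φ →
        ∫ x : ℝ, f 0 x * iteratedDeriv k φ x = (-1 : ℂ) ^ k * ∫ x : ℝ, f k x * φ x) ∧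
      (∫ x : ℝ, f 0 x) = 1 ∧ FT (f 0) 0 = 1 ∧
      (∀ k : ℕ, PerturbedEigenEq θ (-(k : ℂ)) (f k)) := by
  set a := β / 2 with ha_def
  have ha : 0 < a := by positivity
  have hint : Integrable fun x : ℝ => ‖θ x‖ * Real.exp (a * |x|) := by
    refine hθint.congr (.of_forall fun x => ?_)
    simp only [ha_def]
    ring_nf
  have hθ : Integrable θ := by
    refine hint.mono' hθmeas (.of_forall fun x => ?_)
    exact le_mul_of_one_le_right (norm_nonneg _) (Real.one_le_exp (by positivity))
  have hT := differentiableOn_complexFT hθmeas hint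
  have hTb := fun z (hz : z ∈ strip a) => norm_complexFT_le hint hz
  obtain ⟨q, hq, hqT, Q, hQ⟩ := exists_bounded_quotient ha hT hTb
    (by simpa [complexFT] using hθmass)
  obtain ⟨P, hP0, hP, hPb⟩ := exists_primitive ha hq hQ
  have hG := gaussDecay_eigenFT (fun z hz => (hP z hz).differentiableAt.differentiableWithinAt) hPb
  have hG1 : ∀ k, GaussDecay a fun z => Complex.I * z * eigenFT P k z := fun k => by
    rw [I_mul_mul_eigenFT]
    exact hG (k + 1)
  have hG' : ∀ k, GaussDecay a (eigenFTDeriv P q k) := fun k =>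
    (((hG (k - 1)).const_mul _).add ((hG (k + 1)).const_mul _)).add ((hG k).bdd_mul hq hQ)
  have hd : ∀ k z, z ∈ strip a → HasDerivAt (eigenFT P k) (eigenFTDeriv P q k z) z :=
    fun k z hz => hasDerivAt_eigenFT (hP z hz) k
  have hf : ∀ k x, HasDerivAt (invFT (eigenFT P k)) (invFT (eigenFT P (k + 1)) x) x :=
    fun k x => by simpa only [I_mul_mul_eigenFT] using (hG k).hasDerivAt_invFT ha (hG1 k) x
  have hFT : ∀ (k : ℕ) (ξ : ℝ), FT (invFT (eigenFT P k)) ξ = (Complex.I * ξ) ^ k * fhat0 θ ξ :=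
    fun k ξ => by
      rw [(hG k).FT_invFT ha (hG1 k), eigenFT, fhat0]
      congr 3
      exact (integral_div_eq_primitive ha hq hqT hP hP0 ξ).symm
  have hFT0 : FT (invFT (eigenFT P 0)) 0 = 1 := by
    rw [(hG 0).FT_invFT ha (hG1 0)]
    simp [eigenFT, hP0]
  refine ⟨fun k => invFT (eigenFT P k), fun k => ?_, hFT,
    fun k φ hφ hc => integral_mul_iteratedDeriv hf k hφ hc, by simpa [FT] using hFT0, hFT0,
    fun k => perturbedEigenEq_of_pointwise hf k fun x => ?_⟩
  · obtain ⟨C₀, h₀⟩ := (hG k).exists_norm_invFT_le ha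
    obtain ⟨C₁, h₁⟩ := ((hG' k).const_mul Complex.I).exists_norm_invFT_le ha
    refine memE_of_decay (C₁ := C₁) hβ ((hG k).continuous_invFT ha (hG1 k)) h₀ fun x => ?_
    rw [(hG k).mul_invFT ha (hG' k) (hd k)]
    exact h₁ x
  · have hTG := (hG k).bdd_mul hT hTb
    have hkey : (fun z => Complex.I * eigenFTDeriv P q (k + 1) z)
        = fun z => ((-1 : ℂ) * eigenFT P (k + 2) z + (-(k + 1) : ℂ) * eigenFT P k z)
          + (-1 : ℂ) * (complexFT θ z * eigenFT P k z) := by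
      ext z
      rw [← hqT z]
      simp only [eigenFTDeriv, eigenFT, Nat.add_sub_cancel, pow_succ (Complex.I * z)]
      push_cast
      linear_combination ((k + 1 + (Complex.I * z) ^ 2 + q z * z) * ((Complex.I * z) ^ k
        * Complex.exp (-z ^ 2 / 2 + P z))) * Complex.I_mul_I
    rw [(hG (k + 1)).mul_invFT ha (hG' (k + 1)) (hd (k + 1)), hkey,
      (((hG (k + 2)).const_mul _).add ((hG k).const_mul _)).invFT_add ha (hTG.const_mul _),
      ((hG (k + 2)).const_mul _).invFT_add ha ((hG k).const_mul _), invFT_const_mul,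
      invFT_const_mul, invFT_const_mul, (hG k).conv_invFT ha hθ]
    ring
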